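/- Let m ≥ 2 be an integer and p a prime with p > 3m. Let c₁, c₂, c₃, c₄ be integers with 1 ≤ c_k ≤ m−1 for all k, set b_k = ⌊p·c_k/m⌋, and assume ∑_{k=1}^4 b_k = 2p−2 and b₂+b₃ ≤ b₁+b₄. Let h = f(b₂, b₃, p−1−b₁) ∈ F_p[t]. Then h(1) ≠ 0, and there are at least ⌊p/m⌋ − 1 distinct elements α ∈ F̄_p with α ≠ 0, α ≠ 1 and h(α) = 0. -/

import Mathlib

/-- `fabc p a b c = ∑_{i+j=c} C(a,i)·C(b,j)·t^i` in `F_p[t]`. -/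
noncomputable def fabc (p a b c : ℕ) : Polynomial (ZMod p) :=
  ∑ i ∈ Finset.range (c + 1),
    Polynomial.C ((a.choose i : ZMod p) * (b.choose (c - i) : ZMod p)) * Polynomial.X ^ i

open Polynomial in
/-- A polynomial solving a second order linear differential equation has only simple roots where
the leading coefficient does not vanish, as long as its degree is below the characteristic. -/
theorem rootMultiplicity_le_one_of_ode {K : Type*} [Field K] (p : ℕ) [CharP K p]
    (P Q R H : K[X]) (hH : H ≠ 0) (hdeg : H.natDegree < p)
    (hode : P * derivative (derivative H) + Q * derivative H + R * H = 0)
    (α : K) (hα : P.eval α ≠ 0) : H.rootMultiplicity α ≤ 1 := by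
  classical
  by_contra! hk
  obtain ⟨g, hg, hgdvd⟩ := exists_eq_pow_rootMultiplicity_mul_and_not_dvd H hH α
  have hkp : H.rootMultiplicity α < p :=
    (count_roots H (a := α) ▸ (Multiset.count_le_card α H.roots).trans (card_roots' H)).trans_lt
      hdeg
  obtain ⟨k, hk2⟩ := Nat.exists_eq_add_of_le hk
  rw [hk2] at hg hkp
  have hcast (n : ℕ) (h0 : 0 < n) (hn : n < p) : (n : K) ≠ 0 := fun h =>
    absurd (Nat.le_of_dvd h0 ((CharP.cast_eq_zero_iff K p n).mp h)) (by omega)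
  have h1 := hcast (k + 1) (by omega) (by omega)
  have h2 := hcast (k + 2) (by omega) (by omega)
  set Y : K[X] := X - C α with hY
  have hYd : derivative Y = 1 := by simp [hY]
  have hg' : H = Y ^ (k + 2) * g := by rw [hg]; congr 2; omega
  have key : Y ^ k * (P * (C ((k + 2 : ℕ) : K) * C ((k + 1 : ℕ) : K) * g
      + 2 * C ((k + 2 : ℕ) : K) * Y * derivative g + Y ^ 2 * derivative (derivative g))
      + Q * (C ((k + 2 : ℕ) : K) * Y * g + Y ^ 2 * derivative g) + R * (Y ^ 2 * g)) = 0 := by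
    rw [← hode, hg']
    simp only [derivative_mul, derivative_pow, hYd, derivative_add, mul_one,
      Nat.add_sub_cancel, show k + 2 - 1 = k + 1 by omega, map_natCast]
    push_cast
    simp only [derivative_add, derivative_natCast, derivative_ofNat]
    ring
  have hY0 : Y ≠ 0 := X_sub_C_ne_zero α
  have key2 := congrArg (eval α) ((mul_eq_zero.mp key).resolve_left (pow_ne_zero _ hY0))
  have hYα : eval α Y = 0 := by simp [hY]
  simp only [eval_add, eval_mul, eval_pow, hYα, eval_C, eval_zero] at key2
  have hgα : eval α g ≠ 0 := fun h => hgdvd (dvd_iff_isRoot.mpr h)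
  have : eval α P * ((k + 2 : ℕ) * (k + 1 : ℕ) * eval α g) = 0 := by
    rw [← key2]; ring
  exact mul_ne_zero hα (mul_ne_zero (mul_ne_zero h2 h1) hgα) this

theorem coeff_fabc (p a b c n : ℕ) : (fabc p a b c).coeff n =
    if n ≤ c then (a.choose n : ZMod p) * (b.choose (c - n) : ZMod p) else 0 := by
  simp only [fabc, Polynomial.finsetSum_coeff, Polynomial.coeff_C_mul_X_pow]
  simp

theorem cast_choose_succ_mul (R : Type*) [CommRing R] (a n : ℕ) :
    (a.choose (n + 1) : R) * (n + 1) = a.choose n * (a - n) := by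
  rcases le_or_gt n a with h | h
  · have := Nat.choose_succ_right_eq a n
    rw [← Nat.cast_sub h]
    exact_mod_cast congrArg (Nat.cast (R := R)) this
  · simp [Nat.choose_eq_zero_of_lt h, Nat.choose_eq_zero_of_lt (h.trans n.lt_succ_self)]

theorem coeff_fabc_succ (p a b c n : ℕ) :
    ((n : ZMod p) + 1) * (n + 1 + b - c) * (fabc p a b c).coeff (n + 1) =
      (a - n) * (c - n) * (fabc p a b c).coeff n := by
  rw [coeff_fabc, coeff_fabc]
  rcases lt_trichotomy n c with h | rfl | h
  · obtain ⟨d, rfl⟩ := Nat.exists_eq_add_of_lt h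
    have h1 := cast_choose_succ_mul (ZMod p) a n
    have h2 := cast_choose_succ_mul (ZMod p) b d
    rw [if_pos (by omega), if_pos (by omega), show n + d + 1 - (n + 1) = d by omega,
      show n + d + 1 - n = d + 1 by omega]
    push_cast
    linear_combination (b.choose d : ZMod p) * (b - d) * h1
      - (a.choose n : ZMod p) * (a - n) * h2
  · simp
  · simp [show ¬ n ≤ c by omega, show ¬ n + 1 ≤ c by omega]

open Polynomial in
/-- The hypergeometric differential equation. -/
theorem fabc_ode (p a b c : ℕ) :
    X * (1 - X) * derivative (derivative (fabc p a b c))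
      + (C (1 + b - c : ZMod p) - C (1 - a - c : ZMod p) * X) * derivative (fabc p a b c)
      + C (-(a * c) : ZMod p) * fabc p a b c = 0 := by
  have hrw : X * (1 - X) * derivative (derivative (fabc p a b c))
      + (C (1 + b - c : ZMod p) - C (1 - a - c : ZMod p) * X) * derivative (fabc p a b c)
      + C (-(a * c) : ZMod p) * fabc p a b c =
    X * derivative (derivative (fabc p a b c)) - X * (X * derivative (derivative (fabc p a b c)))
      + C (1 + b - c : ZMod p) * derivative (fabc p a b c)
      - C (1 - a - c : ZMod p) * (X * derivative (fabc p a b c))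
      + C (-(a * c) : ZMod p) * fabc p a b c := by ring
  rw [hrw]
  ext n
  have key := coeff_fabc_succ p a b c n
  rcases n with _ | _ | n <;>
  · simp only [coeff_add, coeff_sub, coeff_C_mul, coeff_X_mul, coeff_X_mul_zero, coeff_derivative,
      coeff_zero]
    push_cast at key ⊢
    linear_combination key

theorem eval_one_fabc (p a b c : ℕ) :
    Polynomial.eval 1 (fabc p a b c) = ((a + b).choose c : ZMod p) := by
  rw [Nat.add_choose_eq, Finset.Nat.sum_antidiagonal_eq_sum_range_succ_mk]
  simp [fabc, Polynomial.eval_finsetSum]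

theorem cast_choose_ne_zero (p : ℕ) [Fact p.Prime] {n k : ℕ} (hn : n < p) (hk : k ≤ n) :
    (n.choose k : ZMod p) ≠ 0 := by
  have hp : p.Prime := Fact.out
  rw [Ne, ZMod.natCast_eq_zero_iff]
  intro h
  have h3 : p ∣ n.factorial := by
    rw [← Nat.choose_mul_factorial_mul_factorial hk, mul_assoc]
    exact h.mul_right _
  exact absurd ((hp.dvd_factorial).mp h3) (by omega)

theorem coeff_fabc_ne_zero (p : ℕ) [Fact p.Prime] {a b c n : ℕ} (ha : a < p) (hb : b < p)
    (hna : n ≤ a) (hnc : n ≤ c) (hcb : c - n ≤ b) : (fabc p a b c).coeff n ≠ 0 := by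
  rw [coeff_fabc, if_pos hnc]
  exact mul_ne_zero (cast_choose_ne_zero p ha hna) (cast_choose_ne_zero p hb hcb)

theorem natDegree_fabc_le (p a b c : ℕ) : (fabc p a b c).natDegree ≤ c :=
  Polynomial.natDegree_le_iff_coeff_eq_zero.mpr fun n hn => by
    rw [coeff_fabc, if_neg (by omega)]

open Polynomial in
theorem exists_roots_fabc (p : ℕ) [Fact p.Prime] {a b c : ℕ} (hab : a + b < p) (hc : c < p)
    (hcab : c ≤ a + b) :
    ∃ S : Finset (AlgebraicClosure (ZMod p)), min a c - (c - b) ≤ S.card ∧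
      ∀ α ∈ S, α ≠ 0 ∧ α ≠ 1 ∧ aeval α (fabc p a b c) = 0 := by
  classical
  set K := AlgebraicClosure (ZMod p)
  have : CharP K p := charP_of_injective_algebraMap (algebraMap (ZMod p) K).injective p
  set H : K[X] := (fabc p a b c).map (algebraMap (ZMod p) K) with hHdef
  have hlo : H.coeff (c - b) ≠ 0 := by
    rw [hHdef, coeff_map, Ne, map_eq_zero]
    exact coeff_fabc_ne_zero p (by omega) (by omega) (by omega) (by omega) (by omega)
  have hhi : H.coeff (min a c) ≠ 0 := by
    rw [hHdef, coeff_map, Ne, map_eq_zero]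
    exact coeff_fabc_ne_zero p (by omega) (by omega) (by omega) (by omega) (by omega)
  have hH0 : H ≠ 0 := fun h => hlo (by simp [h])
  have hdeg : H.natDegree < p := by
    rw [hHdef, natDegree_map]
    exact (natDegree_fabc_le p a b c).trans_lt hc
  have h1 : H.eval 1 ≠ 0 := by
    rw [hHdef, eval_one_map, eval_one_fabc, Ne, map_eq_zero]
    exact cast_choose_ne_zero p hab hcab
  have hsimple (α : K) (h0 : α ≠ 0) (hα1 : α ≠ 1) : H.rootMultiplicity α ≤ 1 := by
    have hode := congrArg (Polynomial.map (algebraMap (ZMod p) K)) (fabc_ode p a b c)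
    simp only [Polynomial.map_add, Polynomial.map_mul, Polynomial.map_zero,
      ← derivative_map] at hode
    refine rootMultiplicity_le_one_of_ode p _ _ _ H hH0 hdeg hode α ?_
    simpa [sub_eq_zero, h0] using hα1.symm
  refine ⟨H.roots.toFinset.erase 0, ?_, ?_⟩
  · have hcard : H.roots.card = H.natDegree :=
      (IsAlgClosed.splits H).natDegree_eq_card_roots.symm
    have hge : min a c ≤ H.roots.card := hcard ▸ le_natDegree_of_ne_zero hhi
    have hm0 : H.roots.count 0 ≤ c - b := by
      rw [count_roots, rootMultiplicity_eq_natTrailingDegree']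
      exact natTrailingDegree_le_of_ne_zero hlo
    have hsum : H.roots.card ≤ H.roots.count 0 + (H.roots.toFinset.erase 0).card := by
      rw [← Multiset.toFinset_sum_count_eq]
      calc ∑ x ∈ H.roots.toFinset, H.roots.count x
          ≤ ∑ x ∈ insert 0 (H.roots.toFinset.erase 0), H.roots.count x :=
            Finset.sum_le_sum_of_subset fun x hx => by
              by_cases h : x = 0 <;> simp_all
        _ = H.roots.count 0 + ∑ x ∈ H.roots.toFinset.erase 0, H.roots.count x :=
            Finset.sum_insert (Finset.notMem_erase _ _)
        _ ≤ _ := by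
            rw [Finset.card_eq_sum_ones]
            refine Nat.add_le_add_left (Finset.sum_le_sum fun x hx => ?_) _
            rw [Finset.mem_erase, Multiset.mem_toFinset, mem_roots hH0] at hx
            rw [count_roots]
            exact hsimple x hx.1 fun h => h1 (h ▸ hx.2)
    omega
  · intro α hα
    rw [Finset.mem_erase, Multiset.mem_toFinset, mem_roots hH0] at hα
    refine ⟨hα.1, fun h => h1 (h ▸ hα.2), ?_⟩
    rw [aeval_def, ← eval_map]
    exact hα.2

theorem div_le_mul_div_and_add_le (m p k : ℕ) (hm : 2 ≤ m) (hk : 1 ≤ k ∧ k ≤ m - 1) :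
    p / m ≤ p * k / m ∧ p * k / m + p / m ≤ p := by
  refine ⟨Nat.div_le_div_right (Nat.le_mul_of_pos_right p hk.1), ?_⟩
  calc p * k / m + p / m ≤ (p * k + p) / m := Nat.div_add_div_le_add_div
    _ = p * (k + 1) / m := by rw [mul_add, mul_one]
    _ ≤ p * m / m := Nat.div_le_div_right (Nat.mul_le_mul_left p (by omega))
    _ = p := Nat.mul_div_cancel p (by omega)

/-- The arithmetic core of the case `i₀ = 1` of Proposition `Better bound when r=4(2)`:
for `m ≥ 2`, a prime `p > 3m`, integers `1 ≤ c_k ≤ m-1` with `b_k = ⌊p·c_k/m⌋`,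
`∑ b_k = 2p-2` and `b₂+b₃ ≤ b₁+b₄`, the polynomial `h = f(b₂, b₃, p-1-b₁)` satisfies
`h(1) ≠ 0` and has at least `⌊p/m⌋ - 1` distinct roots in `F̄_p ∖ {0,1}`. -/
theorem stmt_19 (m p : ℕ) (hm : 2 ≤ m) [Fact p.Prime] (hp : 3 * m < p)
    (c : Fin 4 → ℕ) (hc : ∀ k, 1 ≤ c k ∧ c k ≤ m - 1)
    (b : Fin 4 → ℕ) (hb : ∀ k, b k = p * c k / m)
    (hsum : ∑ k, b k = 2 * p - 2) (hord : b 1 + b 2 ≤ b 0 + b 3) :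
    Polynomial.eval (1 : ZMod p) (fabc p (b 1) (b 2) (p - 1 - b 0)) ≠ 0 ∧
    ∃ S : Finset (AlgebraicClosure (ZMod p)), p / m - 1 ≤ S.card ∧
      ∀ α ∈ S, α ≠ 0 ∧ α ≠ 1 ∧
        Polynomial.aeval α (fabc p (b 1) (b 2) (p - 1 - b 0)) = 0 := by
  have hb' (k : Fin 4) : p / m ≤ b k ∧ b k + p / m ≤ p := by
    rw [hb]
    exact div_le_mul_div_and_add_le m p (c k) hm (hc k)
  have hpm : 1 ≤ p / m := (Nat.one_le_div_iff (by omega)).mpr (by omega)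
  rw [Fin.sum_univ_four] at hsum
  have h0 := hb' 0
  have h1 := hb' 1
  have h2 := hb' 2
  have h3 := hb' 3
  have hab : b 1 + b 2 < p := by omega
  have hcab : p - 1 - b 0 ≤ b 1 + b 2 := by omega
  refine ⟨?_, ?_⟩
  · rw [eval_one_fabc]
    exact cast_choose_ne_zero p hab hcab
  · obtain ⟨S, hS, hroots⟩ := exists_roots_fabc p hab (by omega) hcab
    exact ⟨S, by omega, hroots⟩
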